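/- (No creation of edge contours with increasing time) Let f : ℝ → ℝ be integrable and of exponential order, let F(x,t) = (f*G_{√t})(x) be the associated heat-equation solution, and let Z = {(x,t) ∈ ℝ × (0,∞) : F_xx(x,t) = 0}. Then for all real numbers 0 < t₁ < t₂, every connected component of Z that contains a point whose second coordinate equals t₂ also contains a point whose second coordinate equals t₁. -/

import Mathlib

open MeasureTheory Real Filter Topology

noncomputable section

/-- `f : ℝ → ℝ` is integrable and of exponential order. -/
def ExpOrder1 (f : ℝ → ℝ) : Prop :=
  Integrable f ∧ ∃ C γ : ℝ, 0 < C ∧ 0 < γ ∧ ∀ᵐ x : ℝ, |f x| ≤ C * Real.exp (-γ * |x|)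

/-- The Gaussian kernel `G_σ(x) = (2πσ²)^{-1/2} e^{-x²/(2σ²)}`. -/
def gaussK (σ x : ℝ) : ℝ := (Real.sqrt (2 * Real.pi * σ ^ 2))⁻¹ * Real.exp (-x ^ 2 / (2 * σ ^ 2))

/-- The heat-equation solution `F(x,t) = (f * G_{√t})(x)` with initial datum `f`. -/
def heatSol (f : ℝ → ℝ) (x t : ℝ) : ℝ := ∫ y, f y * gaussK (Real.sqrt t) (x - y)

/-- `F_xx`, the second partial derivative of the heat solution in `x`. -/
def heatSolXX (f : ℝ → ℝ) (x t : ℝ) : ℝ := iteratedDeriv 2 (fun x' => heatSol f x' t) x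


/-- Two continuous logarithms of proportional functions differ by a constant on a
preconnected set. -/
lemma sub_eq_sub_of_exp_eq_mul_exp {X : Type*} [TopologicalSpace X] {S : Set X}
    (hS : IsPreconnected S) {L M : X → ℂ} (hL : ContinuousOn L S) (hM : ContinuousOn M S) {c : ℂ}
    (h : ∀ x ∈ S, Complex.exp (L x) = c * Complex.exp (M x)) {x y : X} (hx : x ∈ S) (hy : y ∈ S) :
    L x - M x = L y - M y := by
  refine Complex.isCoveringMap_exp.constOn_of_comp hS (g := fun x => L x - M x) (hL.sub hM)
    (fun a ha b hb => ?_) hx hy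
  simp [Complex.exp_sub, h a ha, h b hb, Complex.exp_ne_zero]

lemma exists_continuous_log {g : ℝ × ℝ → ℂ} (hg : Continuous g) (h0 : ∀ x, g x ≠ 0) :
    ∃ L : ℝ × ℝ → ℂ, Continuous L ∧ ∀ x, Complex.exp (L x) = g x := by
  have hs : IsSimplyConnected (Set.univ : Set (ℝ × ℝ)) := by
    rw [IsSimplyConnected]
    exact (Homeomorph.Set.univ (ℝ × ℝ)).toHomotopyEquiv.simplyConnectedSpace
  obtain ⟨L, hL, hE⟩ := Complex.exists_continuousOn_eqOn_exp_comp hs isOpen_univ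
    hg.continuousOn (by simpa using h0)
  exact ⟨L, continuousOn_univ.1 hL, fun x => hE (Set.mem_univ x)⟩

/-- **Janiszewski's theorem**: if neither of two disjoint closed subsets `A`, `B` of the plane
separates `a` from `b`, then `A ∪ B` does not separate `a` from `b`. -/
lemma notMem_of_not_separated {A B P Q : Set (ℝ × ℝ)} (hA : IsClosed A) (hB : IsClosed B)
    (hAB : Disjoint A B) (hP : IsOpen P) (hQ : IsOpen Q) (hPQ : Disjoint P Q)
    (hcov : P ∪ Q = (A ∪ B)ᶜ) {C₁ C₂ : Set (ℝ × ℝ)} (hC₁ : IsPreconnected C₁)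
    (hC₂ : IsPreconnected C₂) (hC₁A : Disjoint C₁ A) (hC₂B : Disjoint C₂ B) {a b : ℝ × ℝ}
    (ha₁ : a ∈ C₁) (hb₁ : b ∈ C₁) (ha₂ : a ∈ C₂) (hb₂ : b ∈ C₂) (haP : a ∈ P) : b ∉ Q := by
  classical
  intro hbQ
  obtain ⟨l, hl0, hl1, -⟩ := exists_continuous_zero_one_of_isClosed hA hB hAB
  have hbP : b ∉ P := fun h => hPQ.le_bot ⟨h, hbQ⟩
  have hfr : ∀ x ∈ frontier P, x ∈ A ∪ B := by
    intro x hx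
    by_contra hn
    have : x ∈ P ∪ Q := hcov ▸ hn
    rcases this with h | h
    · exact (hP.frontier_eq ▸ hx).2 h
    · exact (hPQ.symm.closure_right hQ).le_bot ⟨h, hx.1⟩
  have hlc : Continuous fun x => (l x : ℂ) := Complex.continuous_ofReal.comp l.continuous
  set π' : ℂ := Real.pi * Complex.I with hπ
  have hEpi : Complex.exp π' = -1 := Complex.exp_pi_mul_I
  have hEpin : Complex.exp (-π') = -1 := by rw [Complex.exp_neg, hEpi]; norm_num
  have hE2pi : Complex.exp (π' * 2) = 1 := by
    rw [mul_two, Complex.exp_add, hEpi]; norm_num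
  obtain ⟨L, hL, hE⟩ := exists_continuous_log
    (g := fun x => if x ∈ P then Complex.exp (π' * l x) else Complex.exp (-(π' * l x)))
    (Continuous.if (by
      intro x hx
      rcases hfr x hx with h | h
      · simp [hl0 h]
      · simp [hl1 h, hEpi, hEpin]) (by fun_prop) (by fun_prop))
    (by intro x; split_ifs <;> exact Complex.exp_ne_zero _)
  have h1 := sub_eq_sub_of_exp_eq_mul_exp hC₁ (c := 1) (L := L)
    (M := fun x => if x ∈ P then π' * l x else π' * (2 - l x)) hL.continuousOn
    (ContinuousOn.if (by
      rintro x ⟨hxC, hx⟩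
      rcases hfr x hx with h | h
      · exact (hC₁A.le_bot ⟨hxC, h⟩).elim
      · simp [hl1 h]; norm_num) (by fun_prop) (by fun_prop))
    (by
      intro x _
      rw [hE, one_mul]
      split_ifs
      · rfl
      · rw [mul_sub, Complex.exp_sub, hE2pi, Complex.exp_neg, one_div]) ha₁ hb₁
  have h2 := sub_eq_sub_of_exp_eq_mul_exp hC₂ (c := 1) (L := L)
    (M := fun x => if x ∈ P then π' * l x else -(π' * l x)) hL.continuousOn
    (ContinuousOn.if (by
      rintro x ⟨hxC, hx⟩
      rcases hfr x hx with h | h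
      · simp [hl0 h]
      · exact (hC₂B.le_bot ⟨hxC, h⟩).elim) (by fun_prop) (by fun_prop))
    (by
      intro x _
      rw [hE, one_mul]
      split_ifs <;> rfl) ha₂ hb₂
  simp only [haP, hbP, if_true, if_false] at h1 h2
  have : π' = 0 := by linear_combination (h1 - h2) / 2
  rw [this] at hEpi
  norm_num at hEpi

/-- A path joining two points of the top side of a horizontal strip meets every path descending
from a point between them to a point below the first path. -/
lemma exists_eq_of_crossing {α ν : ℝ → ℂ} (hα : Continuous α) (hν : Continuous ν) {T : ℝ}
    (hα0 : (α 0).im = T) (hα1 : (α 1).im = T) (hν0 : (ν 0).im = T)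
    (hαT : ∀ s, (α s).im ≤ T) (hνT : ∀ r, (ν r).im ≤ T) (hbot : ∀ s, (ν 1).im ≤ (α s).im)
    (h0 : (α 0).re < (ν 0).re) (h1 : (ν 0).re < (α 1).re) : ∃ s r, α s = ν r := by
  by_contra! hne
  set g : ℝ × ℝ → ℂ := fun q => α q.1 - ν q.2 with hg
  have hgc : Continuous g := by fun_prop
  have hg0 : ∀ q, g q ≠ 0 := fun q => sub_ne_zero.2 (hne _ _)
  obtain ⟨L, hL, hE⟩ := exists_continuous_log hgc hg0
  have hU : ∀ S : Set (ℝ × ℝ), IsPreconnected S → (∀ q ∈ S, 0 ≤ (g q).im) → ∀ x ∈ S, ∀ y ∈ S,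
      L x - Complex.log (-Complex.I * g x) = L y - Complex.log (-Complex.I * g y) := by
    intro S hS hpos x hx y hy
    refine sub_eq_sub_of_exp_eq_mul_exp hS (c := Complex.I)
      (M := fun q => Complex.log (-Complex.I * g q)) hL.continuousOn
      (ContinuousOn.clog (by fun_prop) ?_) ?_ hx hy
    · intro q hq
      rw [Complex.mem_slitPlane_iff]
      rcases (hpos q hq).lt_or_eq with h | h
      · left; simpa using h
      · right
        have : (g q).re ≠ 0 := fun h' => hg0 q (Complex.ext h' h.symm)
        simpa using this
    · intro q _
      rw [Complex.exp_log (by simp [hg0 q, Complex.I_ne_zero]), hE, ← mul_assoc]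
      simp
  have hD : ∀ S : Set (ℝ × ℝ), IsPreconnected S → (∀ q ∈ S, (g q).im ≤ 0) → ∀ x ∈ S, ∀ y ∈ S,
      L x - Complex.log (Complex.I * g x) = L y - Complex.log (Complex.I * g y) := by
    intro S hS hpos x hx y hy
    refine sub_eq_sub_of_exp_eq_mul_exp hS (c := -Complex.I)
      (M := fun q => Complex.log (Complex.I * g q)) hL.continuousOn
      (ContinuousOn.clog (by fun_prop) ?_) ?_ hx hy
    · intro q hq
      rw [Complex.mem_slitPlane_iff]
      rcases (hpos q hq).lt_or_eq with h | h
      · left; simpa using h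
      · right
        have : (g q).re ≠ 0 := fun h' => hg0 q (Complex.ext h' h)
        simpa using this
    · intro q _
      rw [Complex.exp_log (by simp [hg0 q, Complex.I_ne_zero]), hE, ← mul_assoc]
      simp
  have vert : ∀ s : ℝ, IsPreconnected ({s} ×ˢ (Set.univ : Set ℝ)) := fun s =>
    isPreconnected_singleton.prod isPreconnected_univ
  have horiz : ∀ r : ℝ, IsPreconnected ((Set.univ : Set ℝ) ×ˢ {r}) := fun s =>
    isPreconnected_univ.prod isPreconnected_singleton
  have e1 := hU _ (vert 0) (by rintro ⟨s, r⟩ ⟨rfl, -⟩; simp [hg, hα0, hνT]) (0, 0) (by simp)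
    (0, 1) (by simp)
  have e2 := hU _ (horiz 1) (by rintro ⟨s, r⟩ ⟨-, rfl⟩; simp [hg, hbot]) (0, 1) (by simp)
    (1, 1) (by simp)
  have e3 := hU _ (vert 1) (by rintro ⟨s, r⟩ ⟨rfl, -⟩; simp [hg, hα1, hνT]) (1, 1) (by simp)
    (1, 0) (by simp)
  have e4 := hD _ (horiz 0) (by rintro ⟨s, r⟩ ⟨-, rfl⟩; simp [hg, hν0, hαT]) (0, 0) (by simp)
    (1, 0) (by simp)
  have e5 := (e1.trans e2).trans e3
  have ga : g (0, 0) = (((ν 0).re - (α 0).re : ℝ) : ℂ) * (-1) := by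
    apply Complex.ext <;> simp [hg, hα0, hν0]
  have gb : g (1, 0) = (((α 1).re - (ν 0).re : ℝ) : ℂ) := by
    apply Complex.ext <;> simp [hg, hα1, hν0]
  rw [ga, gb] at e4 e5
  have A1 : 0 < (ν 0).re - (α 0).re := by linarith
  have B1 : 0 < (α 1).re - (ν 0).re := by linarith
  rw [show -Complex.I * ((((ν 0).re - (α 0).re : ℝ) : ℂ) * (-1)) =
      (((ν 0).re - (α 0).re : ℝ) : ℂ) * Complex.I by ring,
    show -Complex.I * (((α 1).re - (ν 0).re : ℝ) : ℂ) =
      (((α 1).re - (ν 0).re : ℝ) : ℂ) * (-Complex.I) by ring,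
    Complex.log_ofReal_mul A1 Complex.I_ne_zero,
    Complex.log_ofReal_mul B1 (neg_ne_zero.2 Complex.I_ne_zero)] at e5
  rw [show Complex.I * ((((ν 0).re - (α 0).re : ℝ) : ℂ) * (-1)) =
      (((ν 0).re - (α 0).re : ℝ) : ℂ) * (-Complex.I) by ring,
    mul_comm Complex.I,
    Complex.log_ofReal_mul A1 (neg_ne_zero.2 Complex.I_ne_zero),
    Complex.log_ofReal_mul B1 Complex.I_ne_zero] at e4
  simp only [Complex.log_I, Complex.log_neg_I] at e4 e5
  have : (Real.pi : ℂ) * Complex.I = 0 := by linear_combination (e4 - e5) / 2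
  simp [Real.pi_ne_zero] at this

lemma isOpen_diff_pathComponentIn {X : Type*} [TopologicalSpace X] [LocallyPathConnectedSpace X]
    {O : Set X} (hO : IsOpen O) (x : X) : IsOpen (O \ pathComponentIn O x) := by
  refine isOpen_iff_mem_nhds.2 fun y hy => ?_
  filter_upwards [(hO.pathComponentIn y).mem_nhds (mem_pathComponentIn_self hy.1)] with z hz
  refine ⟨pathComponentIn_subset hz, fun hzx => hy.2 ?_⟩
  rw [← pathComponentIn_congr hzx, pathComponentIn_congr hz]
  exact mem_pathComponentIn_self hy.1

/-- A component of a compact set that misses a closed set `W` is separated from `W` inside the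
compact set. -/
lemma exists_isClosed_split {X : Type*} [TopologicalSpace X] [T2Space X] {Z W : Set X}
    (hZ : IsCompact Z) (hW : IsClosed W) {p : X} (hp : p ∈ Z)
    (h : Disjoint (connectedComponentIn Z p) W) :
    ∃ A B : Set X, IsClosed A ∧ IsClosed B ∧ Disjoint A B ∧ A ∪ B = Z ∧ p ∈ A ∧ Disjoint A W := by
  have : CompactSpace Z := isCompact_iff_compactSpace.1 hZ
  have hW' : IsCompact (((↑) : Z → X) ⁻¹' W) := (hW.preimage continuous_subtype_val).isCompact
  obtain ⟨u, hu⟩ := hW'.elim_finite_subfamily_closed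
    (fun s : { s : Set Z // IsClopen s ∧ (⟨p, hp⟩ : Z) ∈ s } => (s : Set Z))
    (fun s => s.2.1.isClosed) (by
      rw [← connectedComponent_eq_iInter_isClopen]
      refine Set.eq_empty_of_forall_notMem fun y hy => ?_
      refine h.le_bot ⟨?_, hy.1⟩
      rw [connectedComponentIn_eq_image hp]
      exact Set.mem_image_of_mem _ hy.2)
  set C : Set Z := ⋂ i ∈ u, (i : Set Z) with hC
  have hCc : IsClopen C := isClopen_biInter_finset fun i _ => i.2.1
  refine ⟨(↑) '' C, (↑) '' Cᶜ, (hCc.isClosed.isCompact.image continuous_subtype_val).isClosed,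
    (hCc.compl.isClosed.isCompact.image continuous_subtype_val).isClosed, ?_, ?_, ?_, ?_⟩
  · exact (Set.disjoint_image_iff Subtype.val_injective).2 disjoint_compl_right
  · rw [← Set.image_union, Set.union_compl_self, Set.image_univ, Subtype.range_coe]
  · exact ⟨⟨p, hp⟩, Set.mem_iInter₂.2 fun i _ => i.2.2, rfl⟩
  · rw [Set.disjoint_left]
    rintro _ ⟨y, hy, rfl⟩ hyW
    exact (Set.eq_empty_iff_forall_notMem.1 hu y) ⟨hyW, hy⟩

/-- `u` is a bounded solution of the heat equation `u_t = u_xx / 2` on the slab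
`ℝ × [t₁, t₂]`. -/
structure IsBoundedHeat (u : ℝ × ℝ → ℝ) (t₁ t₂ : ℝ) : Prop where
  cont : ContinuousOn u {q | q.2 ∈ Set.Icc t₁ t₂}
  bdd : ∃ M : ℝ, ∀ q : ℝ × ℝ, q.2 ∈ Set.Icc t₁ t₂ → |u q| ≤ M
  heat : ∃ ux uxx : ℝ × ℝ → ℝ, ∀ q : ℝ × ℝ, q.2 ∈ Set.Icc t₁ t₂ →
    HasDerivAt (fun x => u (x, q.2)) (ux q) q.1 ∧
    HasDerivAt (fun x => ux (x, q.2)) (uxx q) q.1 ∧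
    HasDerivAt (fun t => u (q.1, t)) (uxx q / 2) q.2

lemma IsBoundedHeat.const_sub {u : ℝ × ℝ → ℝ} {t₁ t₂ : ℝ} (h : IsBoundedHeat u t₁ t₂) (c : ℝ) :
    IsBoundedHeat (fun q => c - u q) t₁ t₂ := by
  obtain ⟨M, hM⟩ := h.bdd
  obtain ⟨ux, uxx, hu⟩ := h.heat
  refine ⟨continuousOn_const.sub h.cont, ⟨|c| + M, fun q hq => ?_⟩,
    fun q => -ux q, fun q => -uxx q, fun q hq => ?_⟩
  · exact (abs_sub _ _).trans (by gcongr; exact hM q hq)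
  · obtain ⟨h1, h2, h3⟩ := hu q hq
    exact ⟨h1.const_sub c, h2.neg, by simpa [neg_div] using h3.const_sub c⟩

/-- The retraction of the plane onto the slab `ℝ × [t₁, t₂]`. -/
def slabProj (t₁ t₂ : ℝ) (q : ℝ × ℝ) : ℝ × ℝ := (q.1, max t₁ (min t₂ q.2))

lemma continuous_slabProj (t₁ t₂ : ℝ) : Continuous (slabProj t₁ t₂) := by
  unfold slabProj; fun_prop

lemma slabProj_mem {t₁ t₂ : ℝ} (h : t₁ ≤ t₂) (q : ℝ × ℝ) :
    (slabProj t₁ t₂ q).2 ∈ Set.Icc t₁ t₂ :=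
  ⟨le_max_left _ _, max_le h (min_le_left _ _)⟩

lemma slabProj_of_mem {t₁ t₂ : ℝ} {q : ℝ × ℝ} (hq : q.2 ∈ Set.Icc t₁ t₂) :
    slabProj t₁ t₂ q = q := by
  ext <;> simp [slabProj, hq.1, hq.2]

lemma IsBoundedHeat.continuous_comp {u : ℝ × ℝ → ℝ} {t₁ t₂ : ℝ} (h : IsBoundedHeat u t₁ t₂)
    (ht : t₁ ≤ t₂) : Continuous fun q => u (slabProj t₁ t₂ q) :=
  h.cont.comp_continuous (continuous_slabProj t₁ t₂) (slabProj_mem ht)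

lemma JoinedIn.slabProj {O : Set (ℝ × ℝ)} {t₁ t₂ : ℝ} (h : t₁ ≤ t₂) {p q : ℝ × ℝ}
    (hpq : JoinedIn (slabProj t₁ t₂ ⁻¹' O) p q) :
    JoinedIn ({q | q.2 ∈ Set.Icc t₁ t₂} ∩ O) (slabProj t₁ t₂ p) (slabProj t₁ t₂ q) := by
  obtain ⟨γ, hγ⟩ := hpq
  exact ⟨γ.map (continuous_slabProj t₁ t₂), fun s => ⟨slabProj_mem h _, hγ s⟩⟩

lemma IsLocalMax.hasDerivAt_hasDerivAt_nonpos {h h' : ℝ → ℝ} {h'' x : ℝ} (hx : IsLocalMax h x)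
    (h1 : ∀ y, HasDerivAt h (h' y) y) (h2 : HasDerivAt h' h'' x) : h'' ≤ 0 := by
  by_contra! hpos
  have hd : deriv h = h' := funext fun y => (h1 y).deriv
  have hmin : IsLocalMin h x := isLocalMin_of_deriv_deriv_pos (by rwa [hd, h2.deriv])
    hx.deriv_eq_zero (h1 x).continuousAt
  have hconst : h =ᶠ[𝓝 x] fun _ => h x := by
    filter_upwards [hx, hmin] with y hy hy' using le_antisymm hy hy'
  have h0 : h' =ᶠ[𝓝 x] fun _ => 0 := by
    filter_upwards [hconst.eventuallyEq_nhds] with y hy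
    exact (h1 y).unique ((hasDerivAt_const y (h x)).congr_of_eventuallyEq hy)
  exact hpos.ne' (h2.unique ((hasDerivAt_const x (0 : ℝ)).congr_of_eventuallyEq h0))

lemma HasDerivAt.nonneg_of_eventually_le_left {h : ℝ → ℝ} {h' t : ℝ} (hd : HasDerivAt h h' t)
    (hle : ∀ᶠ s in 𝓝[<] t, h s ≤ h t) : 0 ≤ h' := by
  have := (hasDerivAt_iff_tendsto_slope.1 hd).mono_left
    (nhdsWithin_mono t (show Set.Iio t ⊆ {t}ᶜ from fun s hs => ne_of_lt hs))
  refine ge_of_tendsto this ?_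
  filter_upwards [hle, self_mem_nhdsWithin] with s hs hst
  rw [slope_def_field]
  exact div_nonneg_of_nonpos (by linarith) (by have : s < t := hst; linarith)

/-- **Maximum principle**: the positivity set of a bounded solution of the heat equation
connects each of its points on the line `t = t₂` to the line `t = t₁`. -/
lemma IsBoundedHeat.exists_joinedIn {u : ℝ × ℝ → ℝ} {t₁ t₂ : ℝ} (h : IsBoundedHeat u t₁ t₂)
    (ht : t₁ ≤ t₂) {q₀ : ℝ × ℝ} (hq₀ : q₀.2 = t₂) (hpos : 0 < u q₀) :
    ∃ q₁ : ℝ × ℝ, q₁.2 = t₁ ∧ JoinedIn ({q | q.2 ∈ Set.Icc t₁ t₂} ∩ {q | 0 < u q}) q₀ q₁ := by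
  set O : Set (ℝ × ℝ) := slabProj t₁ t₂ ⁻¹' {q | 0 < u q} with hO
  have hOo : IsOpen O := isOpen_lt continuous_const (h.continuous_comp ht)
  have hqs : q₀.2 ∈ Set.Icc t₁ t₂ := ⟨hq₀ ▸ ht, hq₀.le⟩
  have hq₀O : q₀ ∈ O := by simpa [hO, slabProj_of_mem hqs] using hpos
  set D := pathComponentIn O q₀ with hD
  have hDo : IsOpen D := hOo.pathComponentIn q₀
  have hq₀D : q₀ ∈ D := mem_pathComponentIn_self hq₀O
  by_cases hlow : ∃ q ∈ D, q.2 ≤ t₁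
  · obtain ⟨q, hqD, hq⟩ := hlow
    have := JoinedIn.slabProj ht hqD
    rw [slabProj_of_mem hqs] at this
    exact ⟨_, by simp [slabProj, hq], this⟩
  push Not at hlow
  exfalso
  obtain ⟨M, hM⟩ := h.bdd
  obtain ⟨ux, uxx, hu⟩ := h.heat
  obtain ⟨η, hη, hη₀⟩ : ∃ η > 0, η * (q₀.1 ^ 2 + 2 * (q₀.2 - t₁)) < u q₀ := by
    have hnn : 0 ≤ q₀.1 ^ 2 + 2 * (q₀.2 - t₁) := by nlinarith [hqs.1]
    refine ⟨u q₀ / (q₀.1 ^ 2 + 2 * (q₀.2 - t₁) + 1), by positivity, ?_⟩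
    rw [div_mul_eq_mul_div, div_lt_iff₀ (by positivity)]
    nlinarith
  set w : ℝ × ℝ → ℝ := fun q => u q - η * (q.1 ^ 2 + 2 * (q.2 - t₁)) with hw
  have hw₀ : 0 < w q₀ := by simp only [hw]; linarith
  set S : Set (ℝ × ℝ) := {q | q.2 ∈ Set.Icc t₁ t₂} with hS
  have hSc : IsClosed S := isClosed_Icc.preimage continuous_snd
  have hwc : ContinuousOn w S := h.cont.sub (by fun_prop)
  have hwu : ∀ q ∈ S, w q ≤ u q - η * q.1 ^ 2 := by
    intro q hq
    have : 0 ≤ η * (2 * (q.2 - t₁)) := by have := hq.1; apply mul_nonneg hη.le; linarith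
    simp only [hw]; linarith
  set K : Set (ℝ × ℝ) := (S ∩ closure D) ∩ w ⁻¹' Set.Ici (w q₀) with hK
  have hKs : IsClosed K := by
    rw [hK]
    exact (hwc.mono Set.inter_subset_left).preimage_isClosed_of_isClosed
      (hSc.inter isClosed_closure) isClosed_Ici
  set R : ℝ := M / η + 1
  have hKc : IsCompact K := by
    refine (isCompact_Icc (a := -R) (b := R)).prod (isCompact_Icc (a := t₁) (b := t₂))
      |>.of_isClosed_subset hKs ?_
    rintro q ⟨⟨hqS, -⟩, hqw⟩
    refine ⟨?_, hqS⟩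
    have h1 := hwu q hqS
    have h2 := (le_abs_self _).trans (hM q hqS)
    have h3 : w q₀ ≤ w q := hqw
    have h4 : q.1 ^ 2 ≤ M / η := by rw [le_div_iff₀ hη]; linarith
    exact abs_le.1 (abs_le_of_sq_le_sq (by nlinarith [sq_nonneg q.1]) (by
      have := (sq_nonneg q.1).trans h4; positivity))
  obtain ⟨m, hmK, hmax⟩ := hKc.exists_isMaxOn ⟨q₀, ⟨hqs, subset_closure hq₀D⟩, le_refl (w q₀)⟩
    (hwc.mono fun q hq => hq.1.1)
  obtain ⟨⟨hmS, hmD⟩, hmw⟩ := hmK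
  have hmw : w q₀ ≤ w m := hmw
  have hmO : m ∈ O := by
    have : 0 < u m := by nlinarith [hwu m hmS, sq_nonneg m.1]
    simpa [hO, slabProj_of_mem hmS] using this
  have hmD' : m ∈ D := by
    by_contra hn
    obtain ⟨y, hy, hyD⟩ := mem_closure_iff.1 hmD _ (isOpen_diff_pathComponentIn hOo q₀) ⟨hmO, hn⟩
    exact hy.2 hyD
  have hmt : t₁ < m.2 := hlow m hmD'
  have hmaxD : ∀ q ∈ D, q.2 ≤ t₂ → w q ≤ w m := by
    intro q hq hq2
    by_cases hqw : w q₀ ≤ w q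
    · exact hmax ⟨⟨⟨(hlow q hq).le, hq2⟩, subset_closure hq⟩, hqw⟩
    · linarith
  have hDm : D ∈ 𝓝 m := hDo.mem_nhds hmD'
  obtain ⟨-, -, hut⟩ := hu m hmS
  have htime : 0 ≤ uxx m / 2 - η * 2 := by
    have hd : HasDerivAt (fun t => w (m.1, t)) (uxx m / 2 - η * 2) m.2 := by
      refine hut.sub ?_
      have := ((((hasDerivAt_id m.2).sub_const t₁).const_mul 2).const_add (m.1 ^ 2)).const_mul η
      simpa using this
    refine hd.nonneg_of_eventually_le_left ?_
    have hc : Tendsto (fun t : ℝ => (m.1, t)) (𝓝[<] m.2) (𝓝 m) :=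
      (Continuous.tendsto (by fun_prop) m.2).mono_left nhdsWithin_le_nhds
    filter_upwards [hc hDm, self_mem_nhdsWithin] with t htD htm
    exact hmaxD _ htD ((le_of_lt htm).trans hmS.2)
  have hspace : uxx m - η * 2 ≤ 0 := by
    have hux : ∀ x, HasDerivAt (fun x => u (x, m.2)) (ux (x, m.2)) x := fun x => (hu (x, m.2) hmS).1
    have hd : ∀ x, HasDerivAt (fun x => w (x, m.2)) (ux (x, m.2) - η * (2 * x)) x := by
      intro x
      refine (hux x).sub ?_
      have := ((hasDerivAt_pow 2 x).add_const (2 * (m.2 - t₁))).const_mul η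
      simpa using this
    have hd2 : HasDerivAt (fun x => ux (x, m.2) - η * (2 * x)) (uxx m - η * 2) m.1 := by
      refine (hu m hmS).2.1.sub ?_
      simpa using ((hasDerivAt_id m.1).const_mul 2).const_mul η
    refine IsLocalMax.hasDerivAt_hasDerivAt_nonpos ?_ hd hd2
    have hc : Tendsto (fun x : ℝ => (x, m.2)) (𝓝 m.1) (𝓝 m) :=
      Continuous.tendsto (by fun_prop) m.1
    filter_upwards [hc hDm] with x hx
    exact hmaxD _ hx hmS.2
  linarith

/-- Two points of the top line separated by a zero are not joined inside the positivity set. -/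
lemma IsBoundedHeat.not_joinedIn {u : ℝ × ℝ → ℝ} {t₁ t₂ : ℝ} (h : IsBoundedHeat u t₁ t₂)
    (ht : t₁ ≤ t₂) {a x₀ b : ℝ} (hax : a < x₀) (hxb : x₀ < b) (hx₀ : u (x₀, t₂) = 0) :
    ¬ JoinedIn ({q | q.2 ∈ Set.Icc t₁ t₂} ∩ {q | 0 < u q}) (a, t₂) (b, t₂) := by
  rintro ⟨γ, hγ⟩
  obtain ⟨s₀, -, hs₀⟩ := isCompact_univ.exists_isMinOn Set.univ_nonempty
    (f := fun s => u (γ s)) (h.cont.comp_continuous γ.continuous fun s => (hγ s).1).continuousOn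
  obtain ⟨q₁, hq₁, ν, hν⟩ := (h.const_sub (u (γ s₀))).exists_joinedIn ht (q₀ := (x₀, t₂)) rfl
    (by simpa [hx₀] using (hγ s₀).2)
  have key := exists_eq_of_crossing (T := t₂)
    (α := fun s => Complex.equivRealProdCLM.symm (γ.extend s))
    (ν := fun s => Complex.equivRealProdCLM.symm (ν.extend s))
    (Complex.equivRealProdCLM.symm.continuous.comp γ.continuous_extend)
    (Complex.equivRealProdCLM.symm.continuous.comp ν.continuous_extend)
    (by simp) (by simp) (by simp)
    (fun s => (hγ (Set.projIcc 0 1 zero_le_one s)).1.2)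
    (fun s => (hν (Set.projIcc 0 1 zero_le_one s)).1.2)
    (fun s => by
      have : t₁ ≤ (γ.extend s).2 := (hγ (Set.projIcc 0 1 zero_le_one s)).1.1
      simpa [hq₁] using this)
    (by simpa using hax) (by simpa using hxb)
  obtain ⟨s, r, hsr⟩ := key
  have hsr := Complex.equivRealProdCLM.symm.injective hsr
  have h1 := (hν (Set.projIcc 0 1 zero_le_one r)).2
  have h2 : u (γ s₀) ≤ u (γ (Set.projIcc 0 1 zero_le_one s)) := hs₀ (Set.mem_univ _)
  have h3 : γ (Set.projIcc 0 1 zero_le_one s) = ν (Set.projIcc 0 1 zero_le_one r) := hsr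
  rw [h3] at h2
  simp only [Set.mem_ofPred_eq] at h1
  linarith

lemma IsBoundedHeat.exists_joinedIn_ne {u : ℝ × ℝ → ℝ} {t₁ t₂ : ℝ} (h : IsBoundedHeat u t₁ t₂)
    (ht : t₁ ≤ t₂) {q₀ : ℝ × ℝ} (hq₀ : q₀.2 = t₂) (hne : u q₀ ≠ 0) :
    ∃ q₁ : ℝ × ℝ, q₁.2 = t₁ ∧ JoinedIn ({q | q.2 ∈ Set.Icc t₁ t₂} ∩ {q | u q ≠ 0}) q₀ q₁ := by
  rcases hne.lt_or_gt with hlt | hgt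
  · obtain ⟨q₁, hq₁, hj⟩ := (h.const_sub 0).exists_joinedIn ht hq₀ (by simpa using hlt)
    exact ⟨q₁, hq₁, hj.mono fun q hq => ⟨hq.1, fun h0 => by simp [h0] at hq⟩⟩
  · obtain ⟨q₁, hq₁, hj⟩ := h.exists_joinedIn ht hq₀ hgt
    exact ⟨q₁, hq₁, hj.mono fun q hq => ⟨hq.1, ne_of_gt hq.2⟩⟩

lemma IsBoundedHeat.exists_mem_connectedComponentIn_of_pos {u : ℝ × ℝ → ℝ} {t₁ t₂ : ℝ}
    (h : IsBoundedHeat u t₁ t₂) (ht : t₁ ≤ t₂) {a x₀ b : ℝ} (hax : a < x₀) (hxb : x₀ < b)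
    (hx₀ : u (x₀, t₂) = 0) (hiso : ∀ x ∈ Set.Icc a b, x ≠ x₀ → u (x, t₂) ≠ 0)
    (hapos : 0 < u (a, t₂)) :
    ∃ q ∈ connectedComponentIn ({q | q.2 ∈ Set.Icc t₁ t₂} ∩ {q | u q = 0}) (x₀, t₂),
      q.2 = t₁ := by
  by_contra! hcon
  have hub : u (b, t₂) ≠ 0 := hiso b ⟨(hax.trans hxb).le, le_rfl⟩ hxb.ne'
  obtain ⟨qa, hqa, α, hα⟩ := h.exists_joinedIn_ne ht (q₀ := (a, t₂)) rfl hapos.ne'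
  obtain ⟨qb, hqb, β, hβ⟩ := h.exists_joinedIn_ne ht (q₀ := (b, t₂)) rfl hub
  obtain ⟨R, hR⟩ : ∃ R : ℝ, ∀ q ∈ Set.range α ∪ Set.range β, |q.1| ≤ R := by
    obtain ⟨R, hR⟩ := (((isCompact_range α.continuous).union
      (isCompact_range β.continuous)).image continuous_fst).isBounded.exists_norm_le
    exact ⟨R, fun q hq => hR _ (Set.mem_image_of_mem _ hq)⟩
  have hRa : |a| ≤ R := hR (a, t₂) (Or.inl (Set.mem_range.2 ⟨0, α.source⟩))
  have hRb : |b| ≤ R := hR (b, t₂) (Or.inr (Set.mem_range.2 ⟨0, β.source⟩))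
  have hR0 : -R ≤ R := by linarith [abs_nonneg a]
  set S : Set (ℝ × ℝ) := {q | q.2 ∈ Set.Icc t₁ t₂} with hS
  set Rect : Set (ℝ × ℝ) := Set.Icc (-R) R ×ˢ Set.Icc t₁ t₂ with hRect
  have hRS : Rect ⊆ S := fun q hq => hq.2
  have hzc : IsClosed (S ∩ {q | u q = 0}) :=
    h.cont.preimage_isClosed_of_isClosed (isClosed_Icc.preimage continuous_snd) isClosed_singleton
  have hZc : IsCompact (Rect ∩ (S ∩ {q | u q = 0})) :=
    (isCompact_Icc.prod isCompact_Icc).inter_right hzc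
  have hpS : (x₀, t₂) ∈ S := Set.right_mem_Icc.2 ht
  have hseg : ∀ x ∈ Set.Icc a b, (x, t₂) ∈ Rect := fun x hx =>
    ⟨⟨(abs_le.1 hRa).1.trans hx.1, hx.2.trans (abs_le.1 hRb).2⟩, Set.right_mem_Icc.2 ht⟩
  obtain ⟨A, B, hA, hB, hAB, hcup, hpA, hAW⟩ := exists_isClosed_split hZc
    (W := {q : ℝ × ℝ | q.2 = t₁}) (isClosed_singleton.preimage continuous_snd)
    (p := (x₀, t₂)) ⟨hseg x₀ ⟨hax.le, hxb.le⟩, hpS, hx₀⟩ (by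
      rw [Set.disjoint_left]
      exact fun q hq => hcon q (connectedComponentIn_mono _ Set.inter_subset_right hq))
  set r : ℝ × ℝ → ℝ × ℝ := fun q => (max (-R) (min R q.1), max t₁ (min t₂ q.2)) with hr
  have hrc : Continuous r := by fun_prop
  have hrmem : ∀ q, r q ∈ Rect := fun q =>
    ⟨⟨le_max_left _ _, max_le hR0 (min_le_left _ _)⟩, le_max_left _ _, max_le ht (min_le_left _ _)⟩
  have hrid : ∀ q ∈ Rect, r q = q := by
    rintro q ⟨h1, h2⟩
    ext <;> simp [hr, h1.1, h1.2, h2.1, h2.2]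
  set O : Set (ℝ × ℝ) := slabProj t₁ t₂ ⁻¹' {q | 0 < u q} with hO
  have huc := h.continuous_comp ht
  have hOo : IsOpen O := isOpen_lt continuous_const huc
  set D := pathComponentIn O (a, t₂) with hD
  have hDo : IsOpen D := hOo.pathComponentIn _
  have hDO : D ⊆ O := pathComponentIn_subset
  have hu0 : ∀ q, u (r q) = u (slabProj t₁ t₂ (r q)) := fun q => by
    rw [slabProj_of_mem (hRS (hrmem q))]
  set N : Set (ℝ × ℝ) := {q | u (slabProj t₁ t₂ q) < 0} with hN
  have hNo : IsOpen N := isOpen_lt huc continuous_const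
  have haD : (a, t₂) ∈ D := mem_pathComponentIn_self (by
    have : ((a, t₂) : ℝ × ℝ).2 ∈ Set.Icc t₁ t₂ := Set.right_mem_Icc.2 ht
    simpa [hO, slabProj_of_mem this] using hapos)
  have hra : r (a, t₂) = (a, t₂) := hrid _ (hseg a ⟨le_rfl, (hax.trans hxb).le⟩)
  have hrb : r (b, t₂) = (b, t₂) := hrid _ (hseg b ⟨(hax.trans hxb).le, le_rfl⟩)
  have hbD : (b, t₂) ∉ D := by
    intro hb
    have := JoinedIn.slabProj ht hb
    have htop : ∀ x : ℝ, slabProj t₁ t₂ (x, t₂) = (x, t₂) := fun x =>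
      slabProj_of_mem (show t₂ ∈ Set.Icc t₁ t₂ from Set.right_mem_Icc.2 ht)
    rw [htop, htop] at this
    exact h.not_joinedIn ht hax hxb hx₀ this
  have hbN : (b, t₂) ∈ (O \ D) ∪ N := by
    have hbs : ((b, t₂) : ℝ × ℝ).2 ∈ Set.Icc t₁ t₂ := Set.right_mem_Icc.2 ht
    rcases hub.lt_or_gt with hlt | hgt
    · right; simpa [hN, slabProj_of_mem hbs] using hlt
    · left; exact ⟨by simpa [hO, slabProj_of_mem hbs] using hgt, hbD⟩
  have hnotA : ∀ q ∈ S, u q ≠ 0 → |q.1| ≤ R → q ∉ r ⁻¹' A := by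
    intro q hqS hq hqR hqA
    rw [Set.mem_preimage, hrid q ⟨abs_le.1 hqR, hqS⟩] at hqA
    exact hq (hcup.subset (Or.inl hqA)).2.2
  have hbase : IsPreconnected (Set.Icc (-R) R ×ˢ {t₁} : Set (ℝ × ℝ)) :=
    isPreconnected_Icc.prod isPreconnected_singleton
  have hαqa : qa ∈ Set.range α := ⟨1, α.target⟩
  have hβqb : qb ∈ Set.range β := ⟨1, β.target⟩
  have hqa₁ : qa ∈ (Set.Icc (-R) R ×ˢ {t₁} : Set (ℝ × ℝ)) :=
    ⟨abs_le.1 (hR _ (Or.inl hαqa)), hqa⟩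
  have hqb₁ : qb ∈ (Set.Icc (-R) R ×ˢ {t₁} : Set (ℝ × ℝ)) :=
    ⟨abs_le.1 (hR _ (Or.inr hβqb)), hqb⟩
  have haα : (a, t₂) ∈ Set.range α := ⟨0, α.source⟩
  have hbβ : (b, t₂) ∈ Set.range β := ⟨0, β.source⟩
  have ha₂ : (a, t₂) ∈ Set.Icc a b ×ˢ ({t₂} : Set ℝ) := ⟨⟨le_rfl, (hax.trans hxb).le⟩, rfl⟩
  have hb₂ : (b, t₂) ∈ Set.Icc a b ×ˢ ({t₂} : Set ℝ) := ⟨⟨(hax.trans hxb).le, le_rfl⟩, rfl⟩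
  have hC₁ : IsPreconnected
      (Set.range α ∪ (Set.Icc (-R) R ×ˢ {t₁} : Set (ℝ × ℝ)) ∪ Set.range β) :=
    ((isPreconnected_range α.continuous).union qa hαqa hqa₁ hbase).union qb
      (Or.inr hqb₁) hβqb (isPreconnected_range β.continuous)
  have hC₂ : IsPreconnected (Set.Icc a b ×ˢ {t₂} : Set (ℝ × ℝ)) :=
    isPreconnected_Icc.prod isPreconnected_singleton
  refine notMem_of_not_separated (hA.preimage hrc) (hB.preimage hrc) (hAB.preimage r)
    (P := r ⁻¹' D) (Q := r ⁻¹' ((O \ D) ∪ N)) (hDo.preimage hrc)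
    (((isOpen_diff_pathComponentIn hOo _).union hNo).preimage hrc) ?_ ?_ hC₁ hC₂ ?_ ?_
    (a := (a, t₂)) (b := (b, t₂)) (Or.inl (Or.inl haα)) (Or.inr hbβ) ha₂ hb₂ ?_ ?_
  · refine Disjoint.preimage r (Set.disjoint_left.2 fun q hq hq' => ?_)
    rcases hq' with hq' | hq'
    · exact hq'.2 hq
    · exact lt_asymm (show u (slabProj t₁ t₂ q) < 0 from hq') (hDO hq)
  · rw [← Set.preimage_union, ← Set.preimage_union, ← Set.preimage_compl]
    ext q
    have e1 : r q ∈ A ∪ B ↔ u (r q) = 0 := by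
      rw [hcup]
      exact ⟨fun hq => hq.2.2, fun hq => ⟨hrmem q, hRS (hrmem q), hq⟩⟩
    simp only [Set.mem_preimage, Set.mem_compl_iff, e1]
    constructor
    · rintro (hq | hq | hq) h0
      · exact (show 0 < u (slabProj t₁ t₂ (r q)) from hDO hq).ne' (hu0 q ▸ h0)
      · exact (show 0 < u (slabProj t₁ t₂ (r q)) from hq.1).ne' (hu0 q ▸ h0)
      · exact (show u (slabProj t₁ t₂ (r q)) < 0 from hq).ne (hu0 q ▸ h0)
    · intro hq
      rw [hu0] at hq
      rcases lt_or_gt_of_ne hq with hlt | hgt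
      · exact Or.inr (Or.inr hlt)
      · by_cases hqD : r q ∈ D
        · exact Or.inl hqD
        · exact Or.inr (Or.inl ⟨hgt, hqD⟩)
  · rw [Set.disjoint_left]
    rintro q ((⟨s, rfl⟩ | ⟨hq1, hq2⟩) | ⟨s, rfl⟩)
    · exact hnotA _ (hα s).1 (hα s).2 (hR _ (Or.inl ⟨s, rfl⟩))
    · intro hqA
      have hq2 : q.2 = t₁ := hq2
      rw [Set.mem_preimage, hrid q ⟨hq1, hq2.ge, hq2.trans_le ht⟩] at hqA
      exact hAW.le_bot ⟨hqA, hq2⟩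
    · exact hnotA _ (hβ s).1 (hβ s).2 (hR _ (Or.inr ⟨s, rfl⟩))
  · rw [Set.disjoint_left]
    rintro ⟨x, t⟩ ⟨hx, rfl⟩ hxB
    rw [Set.mem_preimage, hrid _ (hseg x hx)] at hxB
    have hx0 : u (x, t) = 0 := (hcup.subset (Or.inr hxB)).2.2
    have : x = x₀ := by
      by_contra hne
      exact hiso x hx hne hx0
    exact hAB.le_bot ⟨hpA, this ▸ hxB⟩
  · rwa [Set.mem_preimage, hra]
  · rwa [Set.mem_preimage, hrb]

/-- The component of an isolated zero on the line `t = t₂` reaches the line `t = t₁`. -/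
lemma IsBoundedHeat.exists_mem_connectedComponentIn {u : ℝ × ℝ → ℝ} {t₁ t₂ : ℝ}
    (h : IsBoundedHeat u t₁ t₂) (ht : t₁ ≤ t₂) {a x₀ b : ℝ} (hax : a < x₀) (hxb : x₀ < b)
    (hx₀ : u (x₀, t₂) = 0) (hiso : ∀ x ∈ Set.Icc a b, x ≠ x₀ → u (x, t₂) ≠ 0) :
    ∃ q ∈ connectedComponentIn ({q | q.2 ∈ Set.Icc t₁ t₂} ∩ {q | u q = 0}) (x₀, t₂),
      q.2 = t₁ := by
  rcases (hiso a ⟨le_rfl, (hax.trans hxb).le⟩ hax.ne).lt_or_gt with hlt | hgt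
  · simpa using (h.const_sub 0).exists_mem_connectedComponentIn_of_pos ht hax hxb
      (by simpa using hx₀) (by simpa using hiso) (by simpa using hlt)
  · exact h.exists_mem_connectedComponentIn_of_pos ht hax hxb hx₀ hiso hgt

/-- The `n`-th Gaussian moment of `f` about `x`. -/
def gaussMoment (f : ℝ → ℝ) (n : ℕ) (x t : ℝ) : ℝ :=
  ∫ y, f y * ((x - y) ^ n * Real.exp (-(x - y) ^ 2 / (2 * t)))

lemma exists_abs_pow_mul_exp_le (n : ℕ) (T : ℝ) : ∃ M : ℝ, ∀ z t : ℝ, 0 < t → t ≤ T →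
    |z ^ n * Real.exp (-z ^ 2 / (2 * t))| ≤ M := by
  refine ⟨n.factorial * Real.exp (T / 2), fun z t ht htT => ?_⟩
  have hT : 0 < T := ht.trans_le htT
  rw [abs_mul, abs_pow, Real.abs_exp]
  have h1 : |z| ^ n ≤ n.factorial * Real.exp |z| := by
    have := Real.pow_div_factorial_le_exp |z| (abs_nonneg z) n
    rwa [div_le_iff₀' (by positivity)] at this
  have h2 : |z| + -z ^ 2 / (2 * t) ≤ T / 2 := by
    rw [← sq_abs z]
    have : |z| + -|z| ^ 2 / (2 * t) = t / 2 - (|z| - t) ^ 2 / (2 * t) := by field_simp; ring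
    rw [this]
    have : 0 ≤ (|z| - t) ^ 2 / (2 * t) := by positivity
    linarith
  calc |z| ^ n * Real.exp (-z ^ 2 / (2 * t))
      ≤ n.factorial * Real.exp |z| * Real.exp (-z ^ 2 / (2 * t)) := by gcongr
    _ = n.factorial * Real.exp (|z| + -z ^ 2 / (2 * t)) := by rw [Real.exp_add]; ring
    _ ≤ n.factorial * Real.exp (T / 2) := by gcongr

section Moments

variable {f : ℝ → ℝ}

lemma aestronglyMeasurable_gaussMoment (hf : Integrable f) (n : ℕ) (x t : ℝ) :
    AEStronglyMeasurable (fun y => f y * ((x - y) ^ n * Real.exp (-(x - y) ^ 2 / (2 * t)))) :=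
  hf.aestronglyMeasurable.mul (Continuous.aestronglyMeasurable (by fun_prop))

lemma integrable_gaussMoment (hf : Integrable f) (n : ℕ) (x : ℝ) {t : ℝ} (ht : 0 < t) :
    Integrable (fun y => f y * ((x - y) ^ n * Real.exp (-(x - y) ^ 2 / (2 * t)))) := by
  obtain ⟨M, hM⟩ := exists_abs_pow_mul_exp_le n t
  exact hf.mul_bdd (c := M) (Continuous.aestronglyMeasurable (by fun_prop))
    (ae_of_all _ fun y => hM (x - y) t ht le_rfl)

lemma exists_abs_gaussMoment_le (hf : Integrable f) (n : ℕ) (T : ℝ) :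
    ∃ M : ℝ, ∀ x t : ℝ, 0 < t → t ≤ T → |gaussMoment f n x t| ≤ M := by
  obtain ⟨M, hM⟩ := exists_abs_pow_mul_exp_le n T
  refine ⟨∫ y, |f y| * M, fun x t ht htT => ?_⟩
  rw [gaussMoment, ← Real.norm_eq_abs]
  refine norm_integral_le_of_norm_le (hf.abs.mul_const M) (ae_of_all _ fun y => ?_)
  rw [norm_mul]
  exact mul_le_mul_of_nonneg_left (hM _ _ ht htT) (abs_nonneg _)

lemma continuousAt_gaussMoment (hf : Integrable f) (n : ℕ) {q : ℝ × ℝ} (hq : 0 < q.2) :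
    ContinuousAt (fun q : ℝ × ℝ => gaussMoment f n q.1 q.2) q := by
  obtain ⟨M, hM⟩ := exists_abs_pow_mul_exp_le n (q.2 + 1)
  refine continuousAt_of_dominated (bound := fun y => |f y| * M)
    (Eventually.of_forall fun q => aestronglyMeasurable_gaussMoment hf n _ _) ?_
    (hf.abs.mul_const M) (ae_of_all _ fun y => ?_)
  · have h1 : ∀ᶠ p : ℝ × ℝ in 𝓝 q, 0 < p.2 := continuous_snd.continuousAt.eventually_const_lt hq
    have h2 : ∀ᶠ p : ℝ × ℝ in 𝓝 q, p.2 < q.2 + 1 :=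
      continuous_snd.continuousAt.eventually_lt_const (lt_add_one _)
    filter_upwards [h1, h2] with p hp hp'
    refine ae_of_all _ fun y => ?_
    rw [norm_mul]
    exact mul_le_mul_of_nonneg_left (hM _ _ hp hp'.le) (abs_nonneg _)
  · have : 2 * q.2 ≠ 0 := by positivity
    fun_prop (disch := assumption)

lemma hasDerivAt_gaussMoment_fst (hf : Integrable f) (n : ℕ) (x : ℝ) {t : ℝ} (ht : 0 < t) :
    HasDerivAt (fun x => gaussMoment f n x t)
      (n * gaussMoment f (n - 1) x t - gaussMoment f (n + 1) x t / t) x := by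
  obtain ⟨M₁, hM₁⟩ := exists_abs_pow_mul_exp_le (n - 1) t
  obtain ⟨M₂, hM₂⟩ := exists_abs_pow_mul_exp_le (n + 1) t
  have hd := (hasDerivAt_integral_of_dominated_loc_of_deriv_le (μ := volume) (s := Set.univ)
    (F := fun x y => f y * ((x - y) ^ n * Real.exp (-(x - y) ^ 2 / (2 * t))))
    (F' := fun x y => n * (f y * ((x - y) ^ (n - 1) * Real.exp (-(x - y) ^ 2 / (2 * t)))) -
      f y * ((x - y) ^ (n + 1) * Real.exp (-(x - y) ^ 2 / (2 * t))) / t)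
    (bound := fun y => |f y| * (n * M₁ + M₂ / t)) (x₀ := x) univ_mem
    (Eventually.of_forall fun x => aestronglyMeasurable_gaussMoment hf n x t)
    (integrable_gaussMoment hf n x ht)
    (((integrable_gaussMoment hf (n - 1) x ht).const_mul _).sub
      ((integrable_gaussMoment hf (n + 1) x ht).div_const _)).aestronglyMeasurable
    (ae_of_all _ fun y x _ => ?_) (hf.abs.mul_const _) (ae_of_all _ fun y x _ => ?_)).2
  · convert! hd using 1
    rw [integral_sub ((integrable_gaussMoment hf (n - 1) x ht).const_mul _)
      ((integrable_gaussMoment hf (n + 1) x ht).div_const _), integral_const_mul, integral_div]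
    rfl
  · have h1 := hM₁ (x - y) t ht le_rfl
    have h2 := hM₂ (x - y) t ht le_rfl
    calc _ = |f y| * |n * ((x - y) ^ (n - 1) * Real.exp (-(x - y) ^ 2 / (2 * t))) -
          (x - y) ^ (n + 1) * Real.exp (-(x - y) ^ 2 / (2 * t)) / t| := by
          rw [Real.norm_eq_abs, ← abs_mul]; congr 1; ring
      _ ≤ _ := by
          gcongr
          refine (abs_sub _ _).trans ?_
          rw [abs_mul, abs_div, abs_of_pos ht, Nat.abs_cast]
          gcongr
  · have h1 : HasDerivAt (fun x => x - y) 1 x := (hasDerivAt_id x).sub_const y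
    have := ((h1.fun_pow n).mul (((h1.fun_pow 2).neg.div_const (2 * t)).exp)).const_mul (f y)
    convert! this using 1
    simp only [Pi.neg_apply]
    field_simp
    ring

lemma hasDerivAt_gaussMoment_snd (hf : Integrable f) (n : ℕ) (x : ℝ) {t : ℝ} (ht : 0 < t) :
    HasDerivAt (fun t => gaussMoment f n x t) (gaussMoment f (n + 2) x t / (2 * t ^ 2)) t := by
  obtain ⟨M, hM⟩ := exists_abs_pow_mul_exp_le (n + 2) (2 * t)
  have hd := (hasDerivAt_integral_of_dominated_loc_of_deriv_le (μ := volume)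
    (s := Set.Ioo (t / 2) (2 * t))
    (F := fun t y => f y * ((x - y) ^ n * Real.exp (-(x - y) ^ 2 / (2 * t))))
    (F' := fun t y => f y * ((x - y) ^ (n + 2) * Real.exp (-(x - y) ^ 2 / (2 * t))) / (2 * t ^ 2))
    (bound := fun y => |f y| * M / (2 * (t / 2) ^ 2)) (x₀ := t)
    (Ioo_mem_nhds (by linarith) (by linarith))
    (Eventually.of_forall fun t => aestronglyMeasurable_gaussMoment hf n x t)
    (integrable_gaussMoment hf n x ht)
    ((integrable_gaussMoment hf (n + 2) x ht).div_const _).aestronglyMeasurable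
    (ae_of_all _ fun y s hs => ?_) ((hf.abs.mul_const _).div_const _)
    (ae_of_all _ fun y s hs => ?_)).2
  · convert! hd using 1
    rw [integral_div]
    rfl
  · have hs0 : 0 < s := by linarith [hs.1]
    have h1 := hM (x - y) s hs0 hs.2.le
    rw [norm_div, norm_mul, Real.norm_eq_abs, Real.norm_eq_abs, Real.norm_eq_abs,
      abs_of_pos (show 0 < 2 * s ^ 2 by positivity)]
    have := hs.1.le
    gcongr
    exact mul_nonneg (abs_nonneg _) ((abs_nonneg _).trans h1)
  · have hs0 : 0 < s := by linarith [hs.1]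
    have h1 : HasDerivAt (fun s : ℝ => 2 * s) 2 s := by simpa using (hasDerivAt_id s).const_mul 2
    have := ((((hasDerivAt_const s (-(x - y) ^ 2)).div h1 (by positivity)).exp).const_mul
      ((x - y) ^ n)).const_mul (f y)
    convert! this using 1
    simp only [Pi.div_apply]
    field_simp
    ring

lemma heatSol_eq_gaussMoment (x : ℝ) {t : ℝ} (ht : 0 < t) :
    heatSol f x t = (Real.sqrt (2 * Real.pi * t))⁻¹ * gaussMoment f 0 x t := by
  unfold heatSol gaussMoment gaussK
  rw [← integral_const_mul, Real.sq_sqrt ht.le]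
  congr 1 with y
  ring

lemma hasDerivAt_heatSol (hf : Integrable f) (x : ℝ) {t : ℝ} (ht : 0 < t) :
    HasDerivAt (fun x => heatSol f x t)
      (-(Real.sqrt (2 * Real.pi * t))⁻¹ * gaussMoment f 1 x t / t) x := by
  simp only [heatSol_eq_gaussMoment _ ht]
  convert! (hasDerivAt_gaussMoment_fst hf 0 x ht).const_mul _ using 1
  simp; ring

lemma heatSolXX_eq_gaussMoment (hf : Integrable f) (x : ℝ) {t : ℝ} (ht : 0 < t) :
    heatSolXX f x t = (Real.sqrt (2 * Real.pi * t))⁻¹ *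
      (gaussMoment f 2 x t / t ^ 2 - gaussMoment f 0 x t / t) := by
  unfold heatSolXX
  rw [iteratedDeriv_succ, iteratedDeriv_one,
    show deriv (fun x => heatSol f x t) = _ from funext fun x => (hasDerivAt_heatSol hf x ht).deriv]
  have := (((hasDerivAt_gaussMoment_fst hf 1 x ht).const_mul
    (-(Real.sqrt (2 * Real.pi * t))⁻¹)).div_const t).deriv
  rw [this]
  field_simp
  norm_num

lemma hasDerivAt_inv_sqrt_two_pi_mul {t : ℝ} (ht : 0 < t) :
    HasDerivAt (fun t => (Real.sqrt (2 * Real.pi * t))⁻¹)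
      (-(Real.sqrt (2 * Real.pi * t))⁻¹ / (2 * t)) t := by
  have h0 : 0 < 2 * Real.pi * t := by positivity
  have h1 : HasDerivAt (fun t : ℝ => 2 * Real.pi * t) (2 * Real.pi) t := by
    simpa using (hasDerivAt_id t).const_mul (2 * Real.pi)
  convert! (h1.sqrt h0.ne').inv (Real.sqrt_pos.2 h0).ne' using 1
  have hs := Real.sqrt_pos.2 h0
  rw [Real.sq_sqrt h0.le]
  field_simp

lemma isBoundedHeat_heatSolXX (hf : Integrable f) {t₁ t₂ : ℝ} (ht₁ : 0 < t₁) :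
    IsBoundedHeat (fun q => heatSolXX f q.1 q.2) t₁ t₂ := by
  have hpos : ∀ q : ℝ × ℝ, q.2 ∈ Set.Icc t₁ t₂ → 0 < q.2 := fun q hq => ht₁.trans_le hq.1
  refine ⟨fun q hq => ?_, ?_,
    fun q => (Real.sqrt (2 * Real.pi * q.2))⁻¹ *
      (3 * gaussMoment f 1 q.1 q.2 / q.2 ^ 2 - gaussMoment f 3 q.1 q.2 / q.2 ^ 3),
    fun q => (Real.sqrt (2 * Real.pi * q.2))⁻¹ *
      (3 * gaussMoment f 0 q.1 q.2 / q.2 ^ 2 - 6 * gaussMoment f 2 q.1 q.2 / q.2 ^ 3 +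
        gaussMoment f 4 q.1 q.2 / q.2 ^ 4), fun q hq => ⟨?_, ?_, ?_⟩⟩
  · have h0 := hpos q hq
    have heq : (fun q : ℝ × ℝ => heatSolXX f q.1 q.2) =ᶠ[𝓝 q] fun q =>
        (Real.sqrt (2 * Real.pi * q.2))⁻¹ *
          (gaussMoment f 2 q.1 q.2 / q.2 ^ 2 - gaussMoment f 0 q.1 q.2 / q.2) := by
      filter_upwards [continuous_snd.continuousAt.eventually_const_lt h0] with p hp
      exact heatSolXX_eq_gaussMoment hf _ hp
    refine (ContinuousAt.congr ?_ heq.symm).continuousWithinAt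
    have h2 : √(2 * Real.pi * q.2) ≠ 0 := (Real.sqrt_pos.2 (by positivity)).ne'
    have hc : ∀ n : ℕ, ContinuousAt (fun q : ℝ × ℝ => q.2 ^ n) q := fun n => by fun_prop
    have hs : ContinuousAt (fun q : ℝ × ℝ => √(2 * Real.pi * q.2)) q := by fun_prop
    exact (hs.inv₀ h2).mul
      (((continuousAt_gaussMoment hf 2 h0).div (hc 2) (by positivity)).sub
        ((continuousAt_gaussMoment hf 0 h0).div continuousAt_snd h0.ne'))
  · obtain ⟨M₀, hM₀⟩ := exists_abs_gaussMoment_le hf 0 t₂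
    obtain ⟨M₂, hM₂⟩ := exists_abs_gaussMoment_le hf 2 t₂
    refine ⟨(Real.sqrt (2 * Real.pi * t₁))⁻¹ * (M₂ / t₁ ^ 2 + M₀ / t₁), fun q hq => ?_⟩
    have h0 := hpos q hq
    have h2 := hM₂ q.1 q.2 h0 hq.2
    have h0' := hM₀ q.1 q.2 h0 hq.2
    have h2p := (abs_nonneg _).trans h2
    have h0p := (abs_nonneg _).trans h0'
    have h1 := hq.1
    have hs : 0 < √(2 * Real.pi * t₁) := Real.sqrt_pos.2 (by positivity)
    rw [heatSolXX_eq_gaussMoment hf _ h0, abs_mul, abs_of_nonneg (by positivity)]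
    gcongr
    refine (abs_sub _ _).trans ?_
    rw [abs_div, abs_div, abs_of_pos h0, abs_of_pos (pow_pos h0 2)]
    gcongr
  · have h0 := hpos q hq
    simp only [heatSolXX_eq_gaussMoment hf _ h0]
    convert! (((hasDerivAt_gaussMoment_fst hf 2 q.1 h0).div_const (q.2 ^ 2)).sub
      ((hasDerivAt_gaussMoment_fst hf 0 q.1 h0).div_const q.2)).const_mul
        (√(2 * Real.pi * q.2))⁻¹ using 1
    norm_num
    field_simp
    ring_nf
    simp
  · have h0 := hpos q hq
    convert! ((((hasDerivAt_gaussMoment_fst hf 1 q.1 h0).const_mul 3).div_const (q.2 ^ 2)).sub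
      ((hasDerivAt_gaussMoment_fst hf 3 q.1 h0).div_const (q.2 ^ 3))).const_mul
        (√(2 * Real.pi * q.2))⁻¹ using 1
    norm_num
    field_simp
    ring_nf
    simp
  · have h0 := hpos q hq
    have heq : (fun t => heatSolXX f q.1 t) =ᶠ[𝓝 q.2] fun t =>
        (Real.sqrt (2 * Real.pi * t))⁻¹ *
          (gaussMoment f 2 q.1 t / t ^ 2 - gaussMoment f 0 q.1 t / t) := by
      filter_upwards [lt_mem_nhds h0] with t ht
      exact heatSolXX_eq_gaussMoment hf _ ht
    refine HasDerivAt.congr_of_eventuallyEq ?_ heq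
    convert! (hasDerivAt_inv_sqrt_two_pi_mul h0).mul
      (((hasDerivAt_gaussMoment_snd hf 2 q.1 h0).div (hasDerivAt_pow 2 q.2) (by positivity)).sub
      ((hasDerivAt_gaussMoment_snd hf 0 q.1 h0).div (hasDerivAt_id q.2) h0.ne')) using 1
    norm_num
    field_simp
    ring

open ProbabilityTheory in
lemma integrableExpSet_withDensity_ofReal {g : ℝ → ℝ}
    (hg : ∀ s, Integrable fun y => g y * Real.exp (s * y)) :
    integrableExpSet id (volume.withDensity fun y => ENNReal.ofReal (g y)) = Set.univ := by
  have hm : AEMeasurable g := by simpa using (hg 0).aemeasurable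
  refine Set.eq_univ_of_forall fun s => ?_
  rw [integrableExpSet, Set.mem_ofPred_eq, integrable_withDensity_iff_integrable_smul₀'
    hm.ennreal_ofReal (by simp)]
  refine (hg s).pos_part.congr (ae_of_all _ fun y => ?_)
  simp [ENNReal.toReal_ofReal', max_mul_of_nonneg, Real.exp_nonneg]

open ProbabilityTheory in
lemma mgf_withDensity_sub_mgf_withDensity {g : ℝ → ℝ}
    (hg : ∀ s, Integrable fun y => g y * Real.exp (s * y)) (s : ℝ) :
    mgf id (volume.withDensity fun y => ENNReal.ofReal (g y)) s -
      mgf id (volume.withDensity fun y => ENNReal.ofReal (-g y)) s =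
      ∫ y, g y * Real.exp (s * y) := by
  have hm : AEMeasurable g := by simpa using (hg 0).aemeasurable
  have hm' : AEMeasurable fun y => -g y := hm.neg
  rw [mgf, mgf, integral_withDensity_eq_integral_toReal_smul₀ hm.ennreal_ofReal (by simp),
    integral_withDensity_eq_integral_toReal_smul₀ hm'.ennreal_ofReal (by simp),
    ← integral_sub]
  · congr 1 with y
    simp [ENNReal.toReal_ofReal', ← sub_mul, max_zero_sub_max_neg_zero_eq_self]
  · refine (hg s).pos_part.congr (ae_of_all _ fun y => ?_)
    simp [ENNReal.toReal_ofReal', max_mul_of_nonneg, Real.exp_nonneg]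
  · refine (hg s).neg_part.congr (ae_of_all _ fun y => ?_)
    simp [ENNReal.toReal_ofReal', max_mul_of_nonneg, Real.exp_nonneg]

/-- The two-sided Laplace transform of a function is real analytic. -/
lemma analyticOnNhd_integral_mul_exp {g : ℝ → ℝ}
    (hg : ∀ s, Integrable fun y => g y * Real.exp (s * y)) :
    AnalyticOnNhd ℝ (fun s => ∫ y, g y * Real.exp (s * y)) Set.univ := by
  have hg' : ∀ s, Integrable fun y => -g y * Real.exp (s * y) := fun s => by
    simpa using (hg s).neg
  simp only [← mgf_withDensity_sub_mgf_withDensity hg]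
  intro s _
  refine (ProbabilityTheory.analyticAt_mgf ?_).sub (ProbabilityTheory.analyticAt_mgf ?_)
  · simp [integrableExpSet_withDensity_ofReal hg]
  · simp [integrableExpSet_withDensity_ofReal hg']

/-- The two-sided Laplace transform is injective. -/
lemma ae_eq_zero_of_integral_mul_exp_eq_zero {g : ℝ → ℝ}
    (hg : ∀ s, Integrable fun y => g y * Real.exp (s * y))
    (h0 : ∀ s, ∫ y, g y * Real.exp (s * y) = 0) : g =ᵐ[volume] 0 := by
  have hi : Integrable g := by simpa using hg 0
  have hm : AEMeasurable fun y => -g y := hi.neg.aemeasurable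
  set μ := volume.withDensity fun y => ENNReal.ofReal (g y) with hμ
  set μ' := volume.withDensity fun y => ENNReal.ofReal (-g y) with hμ'
  have : IsFiniteMeasure μ := isFiniteMeasure_withDensity_ofReal hi.2
  have : IsFiniteMeasure μ' := isFiniteMeasure_withDensity_ofReal hi.neg.2
  have hmgf : ProbabilityTheory.mgf id μ = ProbabilityTheory.mgf id μ' := funext fun s =>
    sub_eq_zero.1 ((mgf_withDensity_sub_mgf_withDensity hg s).trans (h0 s))
  have hzero : μ = 0 ↔ μ' = 0 := by
    have := congrFun hmgf 0
    rw [ProbabilityTheory.mgf_zero', ProbabilityTheory.mgf_zero'] at this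
    rw [← Measure.measure_univ_eq_zero, ← Measure.measure_univ_eq_zero,
      ← measureReal_eq_zero_iff, ← measureReal_eq_zero_iff, this]
  have heq : μ = μ' := by
    refine Measure.ext_of_complexMGF_id_eq (funext fun z => ?_)
    refine ProbabilityTheory.eqOn_complexMGF_of_mgf' hmgf hzero ?_
    simp [hμ, integrableExpSet_withDensity_ofReal hg]
  rw [hμ, hμ', withDensity_eq_iff_of_sigmaFinite hi.aemeasurable.ennreal_ofReal
    hm.ennreal_ofReal] at heq
  filter_upwards [heq] with y hy
  rcases le_total (g y) 0 with h | h
  · rw [ENNReal.ofReal_of_nonpos h, eq_comm, ENNReal.ofReal_eq_zero] at hy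
    exact le_antisymm h (neg_nonpos.1 hy)
  · rw [ENNReal.ofReal_of_nonpos (neg_nonpos.2 h), ENNReal.ofReal_eq_zero] at hy
    exact le_antisymm hy h

lemma integrable_mul_exp_mul_exp (hf : Integrable f) {t : ℝ} (ht : 0 < t) (s : ℝ) :
    Integrable fun y => f y * Real.exp (-y ^ 2 / (2 * t)) * Real.exp (s * y) := by
  simp only [mul_assoc, ← Real.exp_add]
  refine hf.mul_bdd (c := Real.exp (t * s ^ 2 / 2)) (Continuous.aestronglyMeasurable (by fun_prop))
    (ae_of_all _ fun y => ?_)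
  rw [Real.norm_eq_abs, Real.abs_exp, Real.exp_le_exp]
  have h1 : -y ^ 2 / (2 * t) + s * y = t * s ^ 2 / 2 - (y - t * s) ^ 2 / (2 * t) := by
    field_simp
    ring
  have h2 : 0 ≤ (y - t * s) ^ 2 / (2 * t) := by positivity
  linarith

lemma gaussMoment_zero_eq (x : ℝ) {t : ℝ} (ht : 0 < t) :
    gaussMoment f 0 x t = Real.exp (-x ^ 2 / (2 * t)) *
      ∫ y, f y * Real.exp (-y ^ 2 / (2 * t)) * Real.exp (x / t * y) := by
  rw [gaussMoment, ← integral_const_mul]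
  congr 1 with y
  have : Real.exp (-(x - y) ^ 2 / (2 * t)) =
      Real.exp (-x ^ 2 / (2 * t)) * Real.exp (-y ^ 2 / (2 * t)) * Real.exp (x / t * y) := by
    rw [← Real.exp_add, ← Real.exp_add]
    congr 1
    field_simp
    ring
  rw [this]
  ring

lemma analyticOnNhd_heatSol (hf : Integrable f) {t : ℝ} (ht : 0 < t) :
    AnalyticOnNhd ℝ (fun x => heatSol f x t) Set.univ := by
  simp only [heatSol_eq_gaussMoment _ ht, gaussMoment_zero_eq _ ht]
  intro x _
  have h := analyticOnNhd_integral_mul_exp (integrable_mul_exp_mul_exp hf ht) (x / t) trivial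
  have hlin : AnalyticAt ℝ (fun x => x / t) x := by fun_prop
  have hexp : AnalyticAt ℝ (fun x => Real.exp (-x ^ 2 / (2 * t))) x := by fun_prop
  exact analyticAt_const.mul (hexp.mul (h.fun_comp (f := fun x => x / t) hlin))

lemma analyticOnNhd_heatSolXX (hf : Integrable f) {t : ℝ} (ht : 0 < t) :
    AnalyticOnNhd ℝ (fun x => heatSolXX f x t) Set.univ := by
  simpa only [heatSolXX, iteratedDeriv_eq_iterate] using
    (analyticOnNhd_heatSol hf ht).iterated_deriv 2

lemma tendsto_heatSol_atTop (hf : Integrable f) {t : ℝ} (ht : 0 < t) :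
    Tendsto (fun x => heatSol f x t) atTop (𝓝 0) := by
  simp only [heatSol_eq_gaussMoment _ ht]
  have : Tendsto (fun x => gaussMoment f 0 x t) atTop (𝓝 (∫ _ : ℝ, (0 : ℝ))) := by
    refine tendsto_integral_filter_of_dominated_convergence (fun y => |f y|)
      (Eventually.of_forall fun x => aestronglyMeasurable_gaussMoment hf 0 x t)
      (Eventually.of_forall fun x => ae_of_all _ fun y => ?_) hf.abs (ae_of_all _ fun y => ?_)
    · rw [norm_mul, pow_zero, one_mul, Real.norm_eq_abs, Real.norm_eq_abs, Real.abs_exp]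
      refine mul_le_of_le_one_right (abs_nonneg _) (Real.exp_le_one_iff.2 ?_)
      exact div_nonpos_of_nonpos_of_nonneg (neg_nonpos.2 (sq_nonneg _)) (by positivity)
    · have h1 : Tendsto (fun x : ℝ => (x - y) ^ 2 / (2 * t)) atTop atTop :=
        ((tendsto_pow_atTop two_ne_zero).comp
          (tendsto_atTop_add_const_right _ _ tendsto_id)).atTop_div_const (by positivity)
      have h2 := (Real.tendsto_exp_neg_atTop_nhds_zero.comp h1).const_mul (f y)
      simpa [Function.comp_def, neg_div] using h2
  simpa using this.const_mul (Real.sqrt (2 * Real.pi * t))⁻¹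

/-- Only the zero datum produces a solution whose second derivative vanishes on a whole line. -/
lemma ae_eq_zero_of_heatSolXX_eq_zero (hf : Integrable f) {t : ℝ} (ht : 0 < t)
    (h : ∀ x, heatSolXX f x t = 0) : f =ᵐ[volume] 0 := by
  set F : ℝ → ℝ := fun x => heatSol f x t with hF
  have hd : Differentiable ℝ F := fun x => (hasDerivAt_heatSol hf x ht).differentiableAt
  have hd' : Differentiable ℝ (deriv F) := fun x =>
    ((analyticOnNhd_heatSol hf ht).deriv x trivial).differentiableAt
  have hdd : ∀ x, deriv (deriv F) x = 0 := fun x => by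
    rw [← h x, heatSolXX, iteratedDeriv_succ, iteratedDeriv_one]
  have hlin : ∀ x, F x = F 0 + deriv F 0 * x := by
    intro x
    have := is_const_of_deriv_eq_zero (f := fun x => F x - deriv F 0 * x) (by fun_prop)
      (fun x => by
        have := ((hd x).hasDerivAt.sub ((hasDerivAt_id x).const_mul (deriv F 0))).deriv
        simp only [mul_one, is_const_of_deriv_eq_zero hd' hdd x 0, sub_self] at this
        exact this) x 0
    simp only [mul_zero, sub_zero] at this
    linarith
  have hlim : Tendsto F atTop (𝓝 0) := tendsto_heatSol_atTop hf ht
  have hslope : deriv F 0 = 0 := by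
    refine tendsto_nhds_unique (f := fun x => F (x + 1) - F x) (l := atTop) ?_ ?_
    · refine tendsto_const_nhds.congr fun x => ?_
      rw [hlin, hlin x]
      ring
    · simpa using (hlim.comp (tendsto_atTop_add_const_right _ 1 tendsto_id)).sub hlim
  have hF0 : ∀ x, F x = 0 := by
    have hconst : ∀ x, F x = F 0 := fun x => by rw [hlin, hslope]; ring
    intro x
    rw [hconst x]
    exact tendsto_nhds_unique (tendsto_const_nhds.congr fun x => (hconst x).symm) hlim
  have hg := ae_eq_zero_of_integral_mul_exp_eq_zero (integrable_mul_exp_mul_exp hf ht) fun s => by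
    have : heatSol f (s * t) t = 0 := hF0 (s * t)
    rw [heatSol_eq_gaussMoment _ ht, gaussMoment_zero_eq _ ht,
      mul_div_cancel_right₀ s ht.ne'] at this
    have hs : Real.sqrt (2 * Real.pi * t) ≠ 0 := (Real.sqrt_pos.2 (by positivity)).ne'
    exact (mul_eq_zero.1 ((mul_eq_zero.1 this).resolve_left (inv_ne_zero hs))).resolve_left
      (Real.exp_ne_zero _)
  filter_upwards [hg] with y hy
  simpa [Real.exp_ne_zero] using hy

lemma exists_isolating_Icc (hf : Integrable f) (hne : ¬ f =ᵐ[volume] 0) {t : ℝ} (ht : 0 < t)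
    (x₀ : ℝ) :
    ∃ a b, a < x₀ ∧ x₀ < b ∧ ∀ x ∈ Set.Icc a b, x ≠ x₀ → heatSolXX f x t ≠ 0 := by
  have hev : ∀ᶠ x in 𝓝[≠] x₀, heatSolXX f x t ≠ 0 := by
    by_contra hcon
    refine hne (ae_eq_zero_of_heatSolXX_eq_zero hf ht fun x => ?_)
    refine (analyticOnNhd_heatSolXX hf ht).eqOn_zero_of_preconnected_of_frequently_eq_zero
      isPreconnected_univ (Set.mem_univ x₀) ?_ (Set.mem_univ x)
    exact hcon
  rw [eventually_nhdsWithin_iff, Metric.nhds_basis_closedBall.eventually_iff] at hev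
  obtain ⟨ε, hε, h⟩ := hev
  refine ⟨x₀ - ε, x₀ + ε, by linarith, by linarith, fun x hx => ?_⟩
  rw [← Real.closedBall_eq_Icc] at hx
  exact h hx

lemma heatSolXX_eq_zero_of_ae_eq_zero (h : f =ᵐ[volume] 0) (x t : ℝ) : heatSolXX f x t = 0 := by
  have : (fun x => heatSol f x t) = fun _ => 0 := funext fun x =>
    integral_eq_zero_of_ae (h.mono fun y hy => by simp [hy])
  simp [heatSolXX, this]

end Moments

/-- **No creation of edge contours with increasing time** (Theorem 6): for `0 < t₁ < t₂`,
every connected component of the zero set of `F_xx` in the open upper half-plane that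
reaches the line `t = t₂` also reaches the line `t = t₁`. -/
theorem edge_contours_not_created (f : ℝ → ℝ) (hf : ExpOrder1 f)
    (t₁ t₂ : ℝ) (ht₁ : 0 < t₁) (ht₁₂ : t₁ < t₂) :
    ∀ p : ℝ × ℝ, p ∈ {q : ℝ × ℝ | 0 < q.2 ∧ heatSolXX f q.1 q.2 = 0} → p.2 = t₂ →
      ∃ q ∈ connectedComponentIn {q : ℝ × ℝ | 0 < q.2 ∧ heatSolXX f q.1 q.2 = 0} p,
        q.2 = t₁ := by
  rintro ⟨x₀, t⟩ ⟨hp, hx₀⟩ rfl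
  by_cases hne : f =ᵐ[volume] 0
  · have hZ : {q : ℝ × ℝ | 0 < q.2 ∧ heatSolXX f q.1 q.2 = 0} = Set.univ ×ˢ Set.Ioi 0 := by
      ext q
      simp [heatSolXX_eq_zero_of_ae_eq_zero hne]
    have hconn : IsPreconnected (Set.univ ×ˢ Set.Ioi 0 : Set (ℝ × ℝ)) :=
      isPreconnected_univ.prod isPreconnected_Ioi
    rw [hZ]
    exact ⟨(x₀, t₁), hconn.subset_connectedComponentIn
      (Set.mk_mem_prod (Set.mem_univ x₀) hp) subset_rfl (Set.mk_mem_prod (Set.mem_univ x₀) ht₁), rfl⟩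
  · obtain ⟨a, b, hax, hxb, hiso⟩ := exists_isolating_Icc hf.1 hne hp x₀
    obtain ⟨q, hq, hqt⟩ := (isBoundedHeat_heatSolXX hf.1 ht₁).exists_mem_connectedComponentIn
      ht₁₂.le hax hxb hx₀ hiso
    refine ⟨q, connectedComponentIn_mono _ ?_ hq, hqt⟩
    exact fun r hr => ⟨ht₁.trans_le hr.1.1, hr.2⟩
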